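/- arXiv:math/0507174 — 4 statements merged into one kernel-verified Lean document; each statement's English description precedes it below -/
import Mathlib

section
/- Let X be a proper metric space, G ⊆ X a nonempty closed set, and P : X → X a map such that P x = x for every x ∈ G, and for every x ∉ G, P x ∈ G and dist x (P x) = infDist x G, with uniqueness: for every x ∉ G and every y ∈ G, dist x y = infDist x G implies y = P x. Then P is continuous on all of X. -/
open Filter Topology in
/-- In a proper metric space, any single-valued metric projection onto `G` is continuous. -/
theorem continuous_of_unique_nearest_point
    {X : Type*} [MetricSpace X] [ProperSpace X] {G : Set X} (hG : IsClosed G) {P : X → X}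
    (hmem : ∀ x, P x ∈ G) (hdist : ∀ x, dist x (P x) = Metric.infDist x G)
    (huniq : ∀ x, ∀ y ∈ G, dist x y = Metric.infDist x G → y = P x) :
    Continuous P := by
  refine continuous_iff_continuousAt.2 fun a => ?_
  have hcont : Continuous fun x => dist x a + Metric.infDist x G :=
    (continuous_id.dist continuous_const).add (Metric.continuous_infDist_pt G)
  have hbdd : ∀ᶠ x in 𝓝 a, P x ∈ Metric.closedBall a (Metric.infDist a G + 1) := by
    filter_upwards [hcont.continuousAt.eventually_lt_const
      (show dist a a + Metric.infDist a G < Metric.infDist a G + 1 by simp)] with x hx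
    rw [Metric.mem_closedBall, dist_comm]
    linarith [dist_triangle_left a (P x) x, hdist x]
  refine (isCompact_closedBall _ _).tendsto_nhds_of_unique_mapClusterPt hbdd fun y _ hy => ?_
  obtain ⟨U, hU, hPU⟩ := mapClusterPt_iff_ultrafilter.1 hy
  refine huniq a y (hG.mem_of_tendsto hPU (.of_forall hmem)) ?_
  have hlim : Tendsto (fun x => dist x (P x)) U (𝓝 (dist a y)) :=
    (tendsto_id.mono_left hU).dist hPU
  simp only [hdist] at hlim
  exact tendsto_nhds_unique hlim
    (((Metric.continuous_infDist_pt G).tendsto a).mono_left hU)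

theorem nearest_point_retraction_continuous
    {X : Type*} [MetricSpace X] [ProperSpace X]
    (G : Set X) (hne : G.Nonempty) (hG : IsClosed G)
    (P : X → X)
    (hPG : ∀ x ∈ G, P x = x)
    (hPout : ∀ x ∉ G, P x ∈ G ∧ dist x (P x) = Metric.infDist x G)
    (huniq : ∀ x ∉ G, ∀ y ∈ G, dist x y = Metric.infDist x G → y = P x) :
    Continuous P := by
  refine continuous_of_unique_nearest_point hG (fun x => ?_) (fun x => ?_) fun x y hy hxy => ?_
  all_goals by_cases hx : x ∈ G
  · rwa [hPG x hx]
  · exact (hPout x hx).1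
  · rw [hPG x hx, dist_self, Metric.infDist_zero_of_mem hx]
  · exact (hPout x hx).2
  · rw [hPG x hx]
    rw [Metric.infDist_zero_of_mem hx] at hxy
    exact (dist_eq_zero.1 hxy).symm
  · exact huniq x hx y hy hxy
end

section
/- Let n be a natural number and let G be a nonempty closed subset of the Euclidean space ℝⁿ (EuclideanSpace ℝ (Fin n)) which is a Chebyshev set: for every x ∈ ℝⁿ there exists a unique y ∈ G with dist x y = infDist x G. Then G is convex. -/
open Filter Topology in
/-- If nearest points in a closed set `G` are unique, then nearest points to a convergent sequence
subconverge to the nearest point to the limit. -/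
theorem tendsto_subseq_nearest_point {E : Type*} [NormedAddCommGroup E] [ProperSpace E]
    {G : Set E} (hG : IsClosed G) {x p : E}
    (hp : ∀ y ∈ G, dist x y = Metric.infDist x G → y = p)
    {u q : ℕ → E} (hu : Tendsto u atTop (𝓝 x)) (hq : ∀ k, q k ∈ G)
    (hqd : ∀ k, dist (u k) (q k) = Metric.infDist (u k) G) :
    ∃ s : ℕ → ℕ, StrictMono s ∧ Tendsto (q ∘ s) atTop (𝓝 p) := by
  have hd : Tendsto (fun k => Metric.infDist (u k) G) atTop (𝓝 (Metric.infDist x G)) :=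
    ((Metric.continuous_infDist_pt G).tendsto x).comp hu
  obtain ⟨M, hM⟩ := hd.bddAbove_range
  obtain ⟨R, hR⟩ := (Metric.isBounded_range_of_tendsto u hu).subset_closedBall x
  have hb : ∀ k, q k ∈ Metric.closedBall x (M + R) := by
    intro k
    have h₁ : dist (u k) x ≤ R := hR (Set.mem_range_self k)
    have h₂ : dist (u k) (q k) ≤ M := (hqd k).trans_le (hM (Set.mem_range_self k))
    have h₃ := dist_triangle (q k) (u k) x
    rw [dist_comm (q k) (u k)] at h₃
    exact Metric.mem_closedBall.2 (by linarith)
  obtain ⟨r, -, s, hs, hr⟩ := (isCompact_closedBall x (M + R)).tendsto_subseq hb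
  have hrG : r ∈ G := hG.mem_of_tendsto hr (Eventually.of_forall fun k => hq _)
  have hdist : dist x r = Metric.infDist x G := by
    refine tendsto_nhds_unique ((hu.comp hs.tendsto_atTop).dist hr) ?_
    simpa only [Function.comp_def, hqd] using hd.comp hs.tendsto_atTop
  exact ⟨s, hs, hp r hrG hdist ▸ hr⟩

/-- Stewart's identity in an inner product space. -/
theorem norm_sub_convex_combination_sq {E : Type*} [NormedAddCommGroup E] [InnerProductSpace ℝ E]
    (x g h : E) {a b : ℝ} (hab : a + b = 1) :
    ‖x - (a • g + b • h)‖ ^ 2 = a * ‖x - g‖ ^ 2 + b * ‖x - h‖ ^ 2 - a * b * ‖g - h‖ ^ 2 := by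
  obtain rfl : b = 1 - a := by linarith
  simp only [← real_inner_self_eq_norm_sq, inner_sub_left, inner_sub_right, inner_add_left,
    inner_add_right, real_inner_smul_left, real_inner_smul_right, real_inner_comm x,
    real_inner_comm g h]
  ring

open Filter Topology in
/-- First-order condition for minimisers of `z ↦ (1 + ε) ‖z - y‖² - infDist z G ²`. -/
theorem nearest_point_sub_eq_of_forall_le {E : Type*} [NormedAddCommGroup E]
    [InnerProductSpace ℝ E] [ProperSpace E] {G : Set E} (hG : IsClosed G)
    {P : E → E} (hPG : ∀ z, P z ∈ G) (hPd : ∀ z, dist z (P z) = Metric.infDist z G)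
    (hPu : ∀ z, ∀ y ∈ G, dist z y = Metric.infDist z G → y = P z) {ε : ℝ} {x y : E}
    (hx : ∀ z, (1 + ε) * ‖x - y‖ ^ 2 - Metric.infDist x G ^ 2 ≤
      (1 + ε) * ‖z - y‖ ^ 2 - Metric.infDist z G ^ 2) :
    P x - y = -(ε • (x - y)) := by
  set v : E := -(ε • (x - y) + (P x - y)) with hv
  let t : ℕ → ℝ := fun k => 1 / ((k : ℝ) + 1)
  have ht : Tendsto t atTop (𝓝 0) := tendsto_one_div_add_atTop_nhds_zero_nat
  have hu : Tendsto (fun k => x + t k • v) atTop (𝓝 x) := by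
    simpa using tendsto_const_nhds.add (ht.smul_const v)
  obtain ⟨s, hs, hlim⟩ := tendsto_subseq_nearest_point hG (hPu x) hu
    (fun k => hPG (x + t k • v)) (fun k => hPd _)
  have hineq : ∀ k, 0 ≤ 2 * inner ℝ (ε • (x - y) + (P (x + t k • v) - y)) v
      + t k * (ε * ‖v‖ ^ 2) := by
    intro k
    have htk : 0 < t k := Nat.one_div_pos_of_nat
    have hmin := hx (x + t k • v)
    set p := P (x + t k • v) with hp
    have hle : Metric.infDist x G ^ 2 ≤ ‖x - p‖ ^ 2 := by
      rw [← dist_eq_norm]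
      exact pow_le_pow_left₀ Metric.infDist_nonneg (Metric.infDist_le_dist_of_mem (hPG _)) 2
    rw [← hPd (x + t k • v), ← hp, dist_eq_norm] at hmin
    have expand : ∀ w : E, ‖x + t k • v - w‖ ^ 2 =
        ‖x - w‖ ^ 2 + 2 * t k * inner ℝ (x - w) v + t k ^ 2 * ‖v‖ ^ 2 := by
      intro w
      rw [add_sub_right_comm, norm_add_sq_real, real_inner_smul_right, norm_smul, mul_pow,
        Real.norm_eq_abs, sq_abs]
      ring
    rw [expand, expand] at hmin
    have hin : inner ℝ (ε • (x - y) + (p - y)) v =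
        (1 + ε) * inner ℝ (x - y) v - inner ℝ (x - p) v := by
      simp only [inner_add_left, inner_sub_left, real_inner_smul_left]
      ring
    rw [hin]
    refine nonneg_of_mul_nonneg_right (a := t k) ?_ htk
    nlinarith
  have hlim' : Tendsto (fun k => 2 * inner ℝ (ε • (x - y) + (P (x + t (s k) • v) - y)) v
      + t (s k) * (ε * ‖v‖ ^ 2)) atTop
      (𝓝 (2 * inner ℝ (ε • (x - y) + (P x - y)) v + 0 * (ε * ‖v‖ ^ 2))) :=
    (((tendsto_const_nhds.add (hlim.sub_const y)).inner tendsto_const_nhds).const_mul 2).add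
      ((ht.comp hs.tendsto_atTop).mul_const _)
  have hnonneg := ge_of_tendsto' hlim' fun k => hineq (s k)
  rw [← neg_neg (ε • (x - y) + (P x - y)), ← hv, inner_neg_left, real_inner_self_eq_norm_sq]
    at hnonneg
  have hv0 : v = 0 := by
    rw [← norm_eq_zero, ← sq_eq_zero_iff]
    nlinarith [sq_nonneg ‖v‖]
  rw [hv, neg_eq_zero] at hv0
  exact eq_neg_of_add_eq_zero_right hv0

open Filter Topology in
/-- **Motzkin's theorem**: a closed Chebyshev set in a proper inner product space is convex. -/
theorem convex_of_existsUnique_nearest_point {E : Type*} [NormedAddCommGroup E]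
    [InnerProductSpace ℝ E] [ProperSpace E] {G : Set E} (hG : IsClosed G)
    (hcheb : ∀ x : E, ∃! y, y ∈ G ∧ dist x y = Metric.infDist x G) : Convex ℝ G := by
  choose P hP hPu using hcheb
  intro g hg h hh a b ha hb hab
  set y := a • g + b • h with hy
  set C := a * b * ‖g - h‖ ^ 2
  have hbound : ∀ z, Metric.infDist z G ^ 2 - C ≤ ‖z - y‖ ^ 2 := by
    intro z
    have hle : ∀ w ∈ G, Metric.infDist z G ^ 2 ≤ ‖z - w‖ ^ 2 := fun w hw => by
      rw [← dist_eq_norm]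
      exact pow_le_pow_left₀ Metric.infDist_nonneg (Metric.infDist_le_dist_of_mem hw) 2
    rw [hy, norm_sub_convex_combination_sq z g h hab]
    have h₁ := mul_le_mul_of_nonneg_left (hle g hg) ha
    have h₂ := mul_le_mul_of_nonneg_left (hle h hh) hb
    have h₃ : Metric.infDist z G ^ 2 =
        a * Metric.infDist z G ^ 2 + b * Metric.infDist z G ^ 2 := by
      rw [← add_mul, hab, one_mul]
    linarith
  have key : ∀ ε : ℝ, 0 < ε → Metric.infDist y G ^ 2 ≤ ε * C := by
    intro ε hε
    have hcont : Continuous fun z : E => (1 + ε) * ‖z - y‖ ^ 2 - Metric.infDist z G ^ 2 := by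
      have := Metric.continuous_infDist_pt G
      fun_prop
    have hcoer : ∀ᶠ z in cocompact E, C / ε ≤ ‖z - y‖ ^ 2 := by
      have := (tendsto_pow_atTop two_ne_zero).comp (tendsto_dist_right_cocompact_atTop y)
      simpa only [Function.comp_def, dist_eq_norm] using this.eventually_ge_atTop (C / ε)
    obtain ⟨x, hx⟩ := hcont.exists_forall_le' y (by
      filter_upwards [hcoer] with z hz
      rw [div_le_iff₀' hε] at hz
      rw [sub_self, norm_zero]
      nlinarith [hbound z, sq_nonneg (Metric.infDist y G)])
    have hfoc := nearest_point_sub_eq_of_forall_le hG (fun z => (hP z).1) (fun z => (hP z).2)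
      (fun z w hw hd => hPu z w ⟨hw, hd⟩) hx
    have hle : Metric.infDist y G ≤ ε * ‖x - y‖ := by
      calc Metric.infDist y G ≤ dist y (P x) := Metric.infDist_le_dist_of_mem (hP x).1
        _ = ε * ‖x - y‖ := by
          rw [dist_comm, dist_eq_norm, hfoc, norm_neg, norm_smul, Real.norm_of_nonneg hε.le]
    have hεC : ε * ‖x - y‖ ^ 2 ≤ C := by
      have hxy := hx y
      rw [sub_self, norm_zero] at hxy
      nlinarith [hbound x, sq_nonneg (Metric.infDist y G)]
    calc Metric.infDist y G ^ 2 ≤ (ε * ‖x - y‖) ^ 2 :=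
          pow_le_pow_left₀ Metric.infDist_nonneg hle 2
      _ = ε * (ε * ‖x - y‖ ^ 2) := by ring
      _ ≤ ε * C := mul_le_mul_of_nonneg_left hεC hε.le
  have hlim : Tendsto (fun ε : ℝ => ε * C) (𝓝[>] 0) (𝓝 0) := by
    have : Tendsto (fun ε : ℝ => ε * C) (𝓝 0) (𝓝 (0 * C)) := tendsto_id.mul_const C
    rw [zero_mul] at this
    exact this.mono_left nhdsWithin_le_nhds
  have hzero : Metric.infDist y G ^ 2 ≤ 0 :=
    ge_of_tendsto hlim (eventually_nhdsWithin_of_forall key)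
  rw [hG.mem_iff_infDist_zero ⟨g, hg⟩]
  exact sq_eq_zero_iff.1 (le_antisymm hzero (sq_nonneg _))

theorem motzkin_chebyshev_convex
    (n : ℕ) (G : Set (EuclideanSpace ℝ (Fin n)))
    (hne : G.Nonempty) (hG : IsClosed G)
    (hcheb : ∀ x : EuclideanSpace ℝ (Fin n),
      ∃! y, y ∈ G ∧ dist x y = Metric.infDist x G) :
    Convex ℝ G :=
  convex_of_existsUnique_nearest_point hG hcheb
end

section
/- Let n be a natural number and let G be a nonempty closed subset of the Euclidean space ℝⁿ (EuclideanSpace ℝ (Fin n)) which is a Chebyshev set: for every x ∈ ℝⁿ there exists a unique y ∈ G with dist x y = infDist x G. Then G is a (strong) deformation retract of ℝⁿ: there is a continuous map H : ℝⁿ × [0,1] → ℝⁿ with H (x, 0) = x for all x, H (x, 1) ∈ G for all x, and H (x, t) = x for all x ∈ G and all t ∈ [0,1]. -/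
open Filter Topology in
/-- In a proper metric space, a nearest-point selection onto a closed set is continuous as soon as
nearest points are unique. -/
theorem continuous_of_unique_nearest {α : Type*} [MetricSpace α] [ProperSpace α] {G : Set α}
    (hG : IsClosed G) {p : α → α} (hpG : ∀ x, p x ∈ G)
    (hpd : ∀ x, dist x (p x) = Metric.infDist x G)
    (huniq : ∀ x, ∀ y ∈ G, dist x y = Metric.infDist x G → y = p x) : Continuous p := by
  rw [continuous_iff_continuousAt]
  intro x
  have hlim : Tendsto (fun z => dist x (p z)) (𝓝 x) (𝓝 (Metric.infDist x G)) := by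
    have hinf : Tendsto (fun z => Metric.infDist z G) (𝓝 x) (𝓝 (Metric.infDist x G)) :=
      (Metric.continuous_infDist_pt G).tendsto x
    have hdist : Tendsto (fun z => dist x z) (𝓝 x) (𝓝 0) := by
      simpa using (continuous_const.dist continuous_id : Continuous fun z => dist x z).tendsto x
    refine tendsto_of_tendsto_of_tendsto_of_le_of_le tendsto_const_nhds
      (by simpa using hdist.add hinf) (fun z => Metric.infDist_le_dist_of_mem (hpG z))
      (fun z => ?_)
    simpa only [← hpd z] using dist_triangle x z (p z)
  have hball : ∀ᶠ z in 𝓝 x, p z ∈ Metric.closedBall x (Metric.infDist x G + 1) := by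
    filter_upwards [hlim.eventually_le_const (lt_add_one _)] with z hz
    rwa [Metric.mem_closedBall']
  refine (isCompact_closedBall x _).tendsto_nhds_of_unique_mapClusterPt hball fun y _ hy => ?_
  refine huniq x y ?_ ?_
  · exact isClosed_iff_clusterPt.mp hG y
      (hy.clusterPt.mono (tendsto_principal.mpr (Eventually.of_forall hpG)))
  · have hcl : MapClusterPt (dist x y) (𝓝 x) (fun z => dist x (p z)) :=
      hy.continuousAt_comp (continuous_const.dist continuous_id).continuousAt
    exact eq_of_nhds_neBot (hcl.clusterPt.mono hlim).neBot

theorem chebyshev_deformation_retract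
    (n : ℕ) (G : Set (EuclideanSpace ℝ (Fin n)))
    (hne : G.Nonempty) (hG : IsClosed G)
    (hcheb : ∀ x : EuclideanSpace ℝ (Fin n),
      ∃! y, y ∈ G ∧ dist x y = Metric.infDist x G) :
    ∃ H : EuclideanSpace ℝ (Fin n) × unitInterval → EuclideanSpace ℝ (Fin n),
      Continuous H ∧
      (∀ x, H (x, 0) = x) ∧
      (∀ x, H (x, 1) ∈ G) ∧
      (∀ x ∈ G, ∀ t : unitInterval, H (x, t) = x) := by
  choose p hp huniq using hcheb
  have hcont : Continuous p := continuous_of_unique_nearest hG (fun x => (hp x).1)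
    (fun x => (hp x).2) fun x y hy hd => huniq x y ⟨hy, hd⟩
  refine ⟨fun q => AffineMap.lineMap q.1 (p q.1) (q.2 : ℝ), ?_, fun x => by simp,
    fun x => by simpa using (hp x).1, fun x hx t => ?_⟩
  · simp only [AffineMap.lineMap_apply_module]
    fun_prop
  · have hfix : x = p x := huniq x x ⟨hx, by simp [Metric.infDist_zero_of_mem hx]⟩
    simp [← hfix]
end

section
/- Let n be a natural number and let G₁ and G₂ be closed subsets of the Euclidean space ℝⁿ (EuclideanSpace ℝ (Fin n)), each nonempty and each a Chebyshev set (for every x ∈ ℝⁿ there exists a unique nearest point of the set). If G₁ ∩ G₂ is nonempty, then G₁ ∩ G₂ is also a Chebyshev set: for every x ∈ ℝⁿ there exists a unique y ∈ G₁ ∩ G₂ with dist x y = infDist x (G₁ ∩ G₂). -/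
section Chebyshev

open Metric
open scoped RealInnerProductSpace

variable {E : Type*} [NormedAddCommGroup E] [InnerProductSpace ℝ E] [ProperSpace E]

/-- If `p` is the only possible nearest point to `z` in a closed set, then the nearest points to
all points near `z` lie in any given open half-space containing `p`. -/
lemma exists_pos_forall_lt_inner_of_unique_nearest {G : Set E} (hG : IsClosed G) {z p u : E}
    (huniq : ∀ y ∈ G, dist z y = infDist z G → y = p) {c : ℝ}
    (hc : c < ⟪u, z - p⟫) :
    ∃ δ > 0, ∀ w, dist w z < δ → ∀ y ∈ G, dist w y = infDist w G → c < ⟪u, z - y⟫ := by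
  set K : Set E := G ∩ {y | ⟪u, z - y⟫ ≤ c}
  have hKc : IsClosed K := hG.inter (isClosed_le (by fun_prop) (by fun_prop))
  rcases K.eq_empty_or_nonempty with he | hne
  · refine ⟨1, one_pos, fun w _ y hy _ => ?_⟩
    by_contra! h
    exact (Set.mem_empty_iff_false y).1 (he ▸ ⟨hy, h⟩)
  · obtain ⟨k, hk, hkd⟩ := hKc.exists_infDist_eq_dist hne z
    have hlt : infDist z G < dist z k := by
      refine lt_of_le_of_ne (infDist_le_dist_of_mem hk.1) fun h => ?_
      have hkp := huniq k hk.1 h.symm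
      have := hk.2
      rw [Set.mem_ofPred_eq, hkp] at this
      linarith
    refine ⟨(dist z k - infDist z G) / 2, by linarith, fun w hw y hy hyd => ?_⟩
    by_contra! h
    have h1 : infDist z K ≤ dist z y := infDist_le_dist_of_mem ⟨hy, h⟩
    have h2 := dist_triangle_left z y w
    have h3 : infDist w G ≤ infDist z G + dist w z := infDist_le_infDist_add_dist
    linarith

/-- Off a Chebyshev set, the distance to the set grows at rate arbitrarily close to one in
some direction. -/
lemma exists_dist_lt_infDist_add_lt {G : Set E} (hG : IsClosed G)
    (hcheb : ∀ x, ∃! y, y ∈ G ∧ dist x y = infDist x G) {z : E} (hz : 0 < infDist z G)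
    {a : ℝ} (ha0 : 0 < a) (ha1 : a < 1) {η : ℝ} (hη : 0 < η) :
    ∃ w, dist w z < η ∧ infDist z G + a * dist w z < infDist w G := by
  obtain ⟨p, ⟨hp, hpd⟩, huniq⟩ := hcheb z
  set d := infDist z G with hd
  have hnorm : ‖z - p‖ = d := by rw [← dist_eq_norm, hpd]
  have hc : a * d ^ 2 < ⟪z - p, z - p⟫ := by
    rw [real_inner_self_eq_norm_sq, hnorm]
    nlinarith [pow_pos hz 2]
  obtain ⟨δ, hδ, hδw⟩ := exists_pos_forall_lt_inner_of_unique_nearest hG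
    (fun y hy hyd => huniq y ⟨hy, hyd⟩) hc
  obtain ⟨s, hs, hsmin⟩ := exists_between (lt_min hδ hη)
  set t := s / d with ht
  have htpos : 0 < t := div_pos hs hz
  have hw : dist (z + t • (z - p)) z = t * d := by
    rw [dist_eq_norm, add_sub_cancel_left, norm_smul, hnorm, Real.norm_of_nonneg htpos.le]
  have htd : t * d = s := div_mul_cancel₀ _ hz.ne'
  refine ⟨z + t • (z - p), by rw [hw, htd]; exact hsmin.trans_le (min_le_right _ _), ?_⟩
  obtain ⟨q, ⟨hq, hqd⟩, -⟩ := hcheb (z + t • (z - p))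
  have hin := hδw _ (by rw [hw, htd]; exact hsmin.trans_le (min_le_left _ _)) q hq hqd
  have hzq : d ≤ ‖z - q‖ := by rw [← dist_eq_norm]; exact infDist_le_dist_of_mem hq
  have hexp : infDist (z + t • (z - p)) G ^ 2 =
      ‖z - q‖ ^ 2 + 2 * (t * ⟪z - p, z - q⟫) + (t * d) ^ 2 := by
    rw [← hqd, dist_eq_norm, show z + t • (z - p) - q = (z - q) + t • (z - p) by abel,
      norm_add_sq_real, real_inner_smul_right, norm_smul, hnorm, Real.norm_of_nonneg htpos.le,
      real_inner_comm]
  rw [hw]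
  refine lt_of_pow_lt_pow_left₀ 2 infDist_nonneg ?_
  rw [hexp]
  have h1 : d ^ 2 ≤ ‖z - q‖ ^ 2 := by gcongr
  have h2 : t * (a * d ^ 2) < t * ⟪z - p, z - q⟫ := by gcongr
  have h3 : (a * (t * d)) ^ 2 ≤ (t * d) ^ 2 := by
    have : a * (t * d) ≤ t * d := mul_le_of_le_one_left (by positivity) ha1.le
    gcongr
  linarith [show (d + a * (t * d)) ^ 2 = d ^ 2 + 2 * (t * (a * d ^ 2)) + (a * (t * d)) ^ 2 by ring]

/-- Around a point off a Chebyshev set, every closed ball contains a point whose distance to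
the set is larger by the full radius. -/
lemma exists_dist_le_infDist_add_le {G : Set E} (hG : IsClosed G)
    (hcheb : ∀ x, ∃! y, y ∈ G ∧ dist x y = infDist x G) {x : E} (hx : 0 < infDist x G)
    {r : ℝ} (hr : 0 < r) :
    ∃ z, dist z x ≤ r ∧ infDist x G + r ≤ infDist z G := by
  have hne : (closedBall x r).Nonempty := nonempty_closedBall.2 hr.le
  obtain ⟨m, hm, hmax⟩ := (isCompact_closedBall x r).exists_isMaxOn hne
    (continuous_infDist_pt G).continuousOn
  refine ⟨m, hm, ?_⟩
  have key : ∀ a : ℝ, 0 < a → a < 1 → infDist x G + a * r ≤ infDist m G := by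
    intro a ha0 ha1
    obtain ⟨z, hz, hzmax⟩ := (isCompact_closedBall x r).exists_isMaxOn hne
      (f := fun z => infDist z G - a * dist z x)
      ((continuous_infDist_pt G).sub (by fun_prop)).continuousOn
    have hxz : infDist x G ≤ infDist z G - a * dist z x := by
      simpa using hzmax (mem_closedBall_self hr.le)
    have hzr : dist z x = r := by
      by_contra hzr
      have hlt : dist z x < r := lt_of_le_of_ne hz hzr
      have hzpos : 0 < infDist z G := by
        have : 0 ≤ a * dist z x := by positivity
        linarith
      obtain ⟨w, hwz, hw⟩ := exists_dist_lt_infDist_add_lt hG hcheb hzpos ha0 ha1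
        (sub_pos.2 hlt)
      have htri := dist_triangle w z x
      have hwmax : infDist w G - a * dist w x ≤ infDist z G - a * dist z x :=
        hzmax (mem_closedBall.2 (by linarith))
      nlinarith [mul_le_mul_of_nonneg_left htri ha0.le]
    have hzm : infDist z G ≤ infDist m G := hmax hz
    rw [hzr] at hxz
    linarith
  by_contra! h
  obtain ⟨a, ha, ha1⟩ := exists_between
    (max_lt one_pos ((div_lt_one hr).2 (by linarith : infDist m G - infDist x G < r)))
  have h1 := key a ((le_max_left _ _).trans_lt ha) ha1
  have h2 := (div_lt_iff₀ hr).1 ((le_max_right _ _).trans_lt ha)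
  linarith

/-- Chebyshev sets satisfy the obtuse angle criterion for nearest points. -/
lemma inner_sub_nonpos_of_chebyshev {G : Set E} (hG : IsClosed G)
    (hcheb : ∀ x, ∃! y, y ∈ G ∧ dist x y = infDist x G) {x p y : E} (hp : p ∈ G)
    (hpd : dist x p = infDist x G) (hx : 0 < infDist x G) (hy : y ∈ G) :
    ⟪x - p, y - p⟫ ≤ 0 := by
  by_contra! hpos
  set d := infDist x G with hd
  set c := ⟪x - p, y - p⟫ with hc
  have hr : 0 < d * ‖y - p‖ ^ 2 / c + 1 := by positivity
  set r := d * ‖y - p‖ ^ 2 / c + 1 with hrdef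
  have hrc : r * c = d * ‖y - p‖ ^ 2 + c := by rw [hrdef]; field_simp
  obtain ⟨z, hzx, hz⟩ := exists_dist_le_infDist_add_le hG hcheb hx hr
  have hzp : d + r ≤ ‖(z - x) + (x - p)‖ := by
    rw [sub_add_sub_cancel, ← dist_eq_norm]
    exact hz.trans (infDist_le_dist_of_mem hp)
  have hxp : ‖x - p‖ = d := by rw [← dist_eq_norm, hpd]
  rw [dist_eq_norm] at hzx
  have htri := norm_add_le (z - x) (x - p)
  have hzxr : ‖z - x‖ = r := by linarith
  have hray : SameRay ℝ (z - x) (x - p) := sameRay_iff_norm_add.2 (by linarith)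
  have hsmul : r • (x - p) = d • (z - x) := by
    simpa [hzxr, hxp] using hray.norm_smul_eq
  have hinner : d * ⟪z - p, y - p⟫ = (r + d) * c := by
    rw [← real_inner_smul_left, ← sub_add_sub_cancel z x p, smul_add, ← hsmul, ← add_smul,
      real_inner_smul_left]
  have hle : ‖z - p‖ ≤ ‖(z - p) - (y - p)‖ := by
    rw [sub_sub_sub_cancel_right, ← dist_eq_norm z y, ← sub_add_sub_cancel z x p]
    have := infDist_le_dist_of_mem (x := z) hy
    linarith
  have hsq : ‖z - p‖ ^ 2 ≤ ‖(z - p) - (y - p)‖ ^ 2 := by gcongr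
  rw [norm_sub_sq_real (z - p) (y - p)] at hsq
  nlinarith [mul_nonneg hx.le (sub_nonneg.2 hsq), mul_pos hx hpos,
    mul_nonneg hx.le (sq_nonneg ‖y - p‖)]

/-- **Bunt–Motzkin theorem**: Chebyshev sets in finite-dimensional Euclidean spaces are
convex. -/
theorem convex_of_chebyshev {G : Set E} (hG : IsClosed G)
    (hcheb : ∀ x, ∃! y, y ∈ G ∧ dist x y = infDist x G) : Convex ℝ G := by
  intro y₁ hy₁ y₂ hy₂ a b ha hb hab
  by_contra hx
  set x := a • y₁ + b • y₂ with hxdef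
  have hpos : 0 < infDist x G := (hG.notMem_iff_infDist_pos ⟨y₁, hy₁⟩).1 hx
  obtain ⟨p, ⟨hp, hpd⟩, -⟩ := hcheb x
  have h₁ := inner_sub_nonpos_of_chebyshev hG hcheb hp hpd hpos hy₁
  have h₂ := inner_sub_nonpos_of_chebyshev hG hcheb hp hpd hpos hy₂
  have hcomb : x - p = a • (y₁ - p) + b • (y₂ - p) := by
    rw [smul_sub, smul_sub, sub_add_sub_comm, ← add_smul, hab, one_smul]
  have hself : ⟪x - p, x - p⟫ ≤ 0 := by
    nth_rewrite 2 [hcomb]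
    rw [inner_add_right, real_inner_smul_right, real_inner_smul_right]
    exact add_nonpos (mul_nonpos_of_nonneg_of_nonpos ha h₁)
      (mul_nonpos_of_nonneg_of_nonpos hb h₂)
  exact hx (sub_eq_zero.1 (real_inner_self_nonpos.1 hself) ▸ hp)

/-- Closed nonempty convex sets are Chebyshev sets. -/
lemma existsUnique_dist_eq_infDist_of_convex {K : Set E} (hK : IsClosed K)
    (hconv : Convex ℝ K) (hne : K.Nonempty) (x : E) :
    ∃! y, y ∈ K ∧ dist x y = infDist x K := by
  obtain ⟨p, hp, hpd⟩ := hK.exists_infDist_eq_dist hne x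
  refine ⟨p, ⟨hp, hpd.symm⟩, fun y ⟨hy, hyd⟩ => ?_⟩
  by_contra hyp
  have hmid : midpoint ℝ y p ∈ K := hconv.midpoint_mem hy hp
  have hlt : ‖(1 / 2 : ℝ) • ((x - y) + (x - p))‖ < ‖x - y‖ :=
    (norm_midpoint_lt_iff (by rw [← dist_eq_norm, ← dist_eq_norm, hyd, hpd])).2
      fun h => hyp (sub_right_injective h)
  rw [show (1 / 2 : ℝ) • ((x - y) + (x - p)) = x - midpoint ℝ y p by
    rw [midpoint_eq_smul_add, invOf_eq_inv]; module, ← dist_eq_norm, ← dist_eq_norm, hyd] at hlt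
  exact (infDist_le_dist_of_mem hmid).not_gt hlt

end Chebyshev

theorem chebyshev_inter_chebyshev
    (n : ℕ) (G₁ G₂ : Set (EuclideanSpace ℝ (Fin n)))
    (hG₁ : IsClosed G₁) (hG₂ : IsClosed G₂)
    (hne₁ : G₁.Nonempty) (hne₂ : G₂.Nonempty)
    (hcheb₁ : ∀ x : EuclideanSpace ℝ (Fin n),
      ∃! y, y ∈ G₁ ∧ dist x y = Metric.infDist x G₁)
    (hcheb₂ : ∀ x : EuclideanSpace ℝ (Fin n),
      ∃! y, y ∈ G₂ ∧ dist x y = Metric.infDist x G₂)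
    (hne : (G₁ ∩ G₂).Nonempty) :
    ∀ x : EuclideanSpace ℝ (Fin n),
      ∃! y, y ∈ G₁ ∩ G₂ ∧ dist x y = Metric.infDist x (G₁ ∩ G₂) := by

  exact existsUnique_dist_eq_infDist_of_convex (hG₁.inter hG₂)
    ((convex_of_chebyshev hG₁ hcheb₁).inter (convex_of_chebyshev hG₂ hcheb₂)) hne
end
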